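/- arXiv:2001.04266 — 8 statements merged into one kernel-verified Lean document; each statement's English description precedes it below -/
import Mathlib

section
/- Let I ⊆ ℝ be an open interval and m, n ≥ 1 integers. Let P be the differential operator Pf = f^{(m)} + Σ_{i=0}^{m−2} α_i·f^{(i)} (monic of order m with vanishing coefficient of f^{(m−1)}) with α_0,…,α_{m−2} smooth on I, and let Q be the differential operator Qf = Σ_{j=0}^{n} β_j·f^{(j)} with β_0,…,β_n smooth on I. If P and Q commute, then β_n and β_{n−1} are constant functions on I. -/
open scoped BigOperators

open Finset in
/-- If `h` vanishes to order `q` at `s`, only the two lowest Leibniz terms of the `(q + 1)`-st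
derivative of `g * h` survive at `s`. -/
theorem iteratedDeriv_succ_mul_of_vanishing {g h : ℝ → ℝ} {s : ℝ} {q : ℕ}
    (hg : ContDiffAt ℝ (⊤ : ℕ∞) g s) (hh : ContDiffAt ℝ (⊤ : ℕ∞) h s)
    (hz : ∀ r < q, iteratedDeriv r h s = 0) :
    iteratedDeriv (q + 1) (fun t => g t * h t) s
      = g s * iteratedDeriv (q + 1) h s + (q + 1) * deriv g s * iteratedDeriv q h s := by
  rw [iteratedDeriv_fun_mul (hg.of_le (by exact_mod_cast le_top))
    (hh.of_le (by exact_mod_cast le_top)), sum_range_succ', sum_range_succ']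
  rw [sum_eq_zero fun l hl => by
    rw [hz _ (by have := mem_range.1 hl; omega), mul_zero]]
  simp
  ring

open Finset in
/-- If `h` vanishes to order `i` at `s`, only the lowest Leibniz term of the `i`-th derivative
of `g * h` survives at `s`. -/
theorem iteratedDeriv_mul_of_vanishing {g h : ℝ → ℝ} {s : ℝ} {i : ℕ}
    (hg : ContDiffAt ℝ (⊤ : ℕ∞) g s) (hh : ContDiffAt ℝ (⊤ : ℕ∞) h s)
    (hz : ∀ r < i, iteratedDeriv r h s = 0) :
    iteratedDeriv i (fun t => g t * h t) s = g s * iteratedDeriv i h s := by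
  rw [iteratedDeriv_fun_mul (hg.of_le (by exact_mod_cast le_top))
    (hh.of_le (by exact_mod_cast le_top)), sum_range_succ']
  rw [sum_eq_zero fun l hl => by
    rw [hz _ (by have := mem_range.1 hl; omega), mul_zero]]
  simp

theorem iteratedDeriv_iteratedDeriv (i j : ℕ) (f : ℝ → ℝ) :
    iteratedDeriv i (iteratedDeriv j f) = iteratedDeriv (i + j) f := by
  simp only [iteratedDeriv_eq_iterate, Function.iterate_add_apply]

theorem ContDiff.iteratedDeriv_top {f : ℝ → ℝ} (hf : ContDiff ℝ (⊤ : ℕ∞) f) (j : ℕ) :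
    ContDiff ℝ (⊤ : ℕ∞) (iteratedDeriv j f) := by
  rw [iteratedDeriv_eq_iterate]
  exact hf.iterate_deriv j

theorem iteratedDeriv_sub_const_pow_self (s : ℝ) (k r : ℕ) :
    iteratedDeriv r (fun t => (t - s) ^ k) s = if r = k then (k.factorial : ℝ) else 0 := by
  rw [iteratedDeriv_comp_sub_const (f := fun t : ℝ => t ^ k)]
  simp only [sub_self, iteratedDeriv_fun_pow_zero, Nat.cast_ite, Nat.cast_zero]

open Finset in
/-- If the operators `D ^ m + ∑ i < m - 1, α i * D ^ i` and `∑ j ≤ n, β j * D ^ j` agree, in either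
order of composition, on a function `f` vanishing to order exactly `k = m + p - 1` at `s`, where
`n - 1 ≤ p ≤ n`, and `β j` is locally constant for `j > p`, then `β p` has derivative zero
at `s`. -/
theorem deriv_coeff_eq_zero_of_commute_at {m n p k : ℕ} {α β : ℕ → ℝ → ℝ} {f : ℝ → ℝ} {s : ℝ}
    (hm : 1 ≤ m) (hpn : p ≤ n) (hnp : n ≤ p + 1) (hk : k + 1 = m + p)
    (hα : ∀ i < m - 1, ContDiffAt ℝ (⊤ : ℕ∞) (α i) s)
    (hβ : ∀ j ≤ n, ContDiffAt ℝ (⊤ : ℕ∞) (β j) s)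
    (hconst : ∀ j, p < j → j ≤ n → ∃ b, β j =ᶠ[nhds s] fun _ => b)
    (hf : ContDiff ℝ (⊤ : ℕ∞) f)
    (hz : ∀ r < k, iteratedDeriv r f s = 0) (hfk : iteratedDeriv k f s ≠ 0)
    (hcomm : iteratedDeriv m (fun t => ∑ j ∈ range (n + 1), β j t * iteratedDeriv j f t) s
        + ∑ i ∈ range (m - 1), α i s * iteratedDeriv i
          (fun t => ∑ j ∈ range (n + 1), β j t * iteratedDeriv j f t) s
      = ∑ j ∈ range (n + 1), β j s * iteratedDeriv j
          (fun t => iteratedDeriv m f t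
            + ∑ i ∈ range (m - 1), α i t * iteratedDeriv i f t) s) :
    deriv (β p) s = 0 := by
  have hD : ∀ j, ContDiffAt ℝ (⊤ : ℕ∞) (iteratedDeriv j f) s :=
    fun j => (hf.iteratedDeriv_top j).contDiffAt
  have hle : ∀ i : ℕ, (i : WithTop ℕ∞) ≤ (⊤ : ℕ∞) := fun i => by exact_mod_cast le_top
  have hβD : ∀ j ∈ range (n + 1),
      ContDiffAt ℝ (⊤ : ℕ∞) (fun t => β j t * iteratedDeriv j f t) s := fun j hj =>
    (hβ j (by have := mem_range.1 hj; omega)).mul (hD j)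
  have hαD : ∀ i ∈ range (m - 1),
      ContDiffAt ℝ (⊤ : ℕ∞) (fun t => α i t * iteratedDeriv i f t) s := fun i hi =>
    (hα i (mem_range.1 hi)).mul (hD i)
  have hQ : ∀ i, iteratedDeriv i (fun t => ∑ j ∈ range (n + 1), β j t * iteratedDeriv j f t) s
      = ∑ j ∈ range (n + 1), iteratedDeriv i (fun t => β j t * iteratedDeriv j f t) s :=
    fun i => iteratedDeriv_fun_sum fun j hj => (hβD j hj).of_le (hle i)
  have hP : ∀ j, iteratedDeriv j (fun t => iteratedDeriv m f t
        + ∑ i ∈ range (m - 1), α i t * iteratedDeriv i f t) s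
      = iteratedDeriv (j + m) f s
        + ∑ i ∈ range (m - 1), iteratedDeriv j (fun t => α i t * iteratedDeriv i f t) s := by
    intro j
    rw [iteratedDeriv_fun_add ((hD m).of_le (hle j))
      ((ContDiffAt.sum hαD).of_le (hle j)), iteratedDeriv_iteratedDeriv,
      iteratedDeriv_fun_sum fun i hi => (hαD i hi).of_le (hle j)]
  have low : ∀ (g : ℝ → ℝ) (i j : ℕ), ContDiffAt ℝ (⊤ : ℕ∞) g s → i + j ≤ k →
      iteratedDeriv i (fun t => g t * iteratedDeriv j f t) s
        = g s * iteratedDeriv (i + j) f s := by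
    intro g i j hg hij
    rw [iteratedDeriv_mul_of_vanishing hg (hD j), iteratedDeriv_iteratedDeriv]
    intro r hr
    rw [iteratedDeriv_iteratedDeriv, hz _ (by omega)]
  have hlower : ∑ i ∈ range (m - 1), α i s * iteratedDeriv i
        (fun t => ∑ j ∈ range (n + 1), β j t * iteratedDeriv j f t) s
      = ∑ j ∈ range (n + 1), β j s *
        ∑ i ∈ range (m - 1), iteratedDeriv j (fun t => α i t * iteratedDeriv i f t) s := by
    simp only [hQ, mul_sum]
    rw [sum_comm]
    refine sum_congr rfl fun j hj => sum_congr rfl fun i hi => ?_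
    have hj' := mem_range.1 hj
    have hi' := mem_range.1 hi
    rw [low _ i j (hβ j (by omega)) (by omega), low _ j i (hα i hi') (by omega), add_comm j i]
    ring
  have htop : ∀ j ∈ range (n + 1), iteratedDeriv m (fun t => β j t * iteratedDeriv j f t) s
      = β j s * iteratedDeriv (j + m) f s
        + if j = p then m * deriv (β p) s * iteratedDeriv k f s else 0 := by
    intro j hj
    have hj' := mem_range.1 hj
    rcases lt_trichotomy j p with h | h | h
    · rw [low _ m j (hβ j (by omega)) (by omega), if_neg h.ne, add_zero, add_comm]
    · subst h
      obtain ⟨q, rfl⟩ : ∃ q, m = q + 1 := ⟨m - 1, by omega⟩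
      rw [iteratedDeriv_succ_mul_of_vanishing (hβ j hpn) (hD j) fun r hr => by
        rw [iteratedDeriv_iteratedDeriv, hz _ (by omega)]]
      simp only [iteratedDeriv_iteratedDeriv, if_true]
      rw [show q + j = k by omega, add_comm j]
      push_cast
      ring
    · obtain ⟨b, hb⟩ := hconst j h (by omega)
      have hmul : (fun t => β j t * iteratedDeriv j f t) =ᶠ[nhds s]
          fun t => b * iteratedDeriv j f t := hb.mono fun t ht => by simp only [ht]
      rw [hmul.iteratedDeriv_eq, iteratedDeriv_const_mul_field, iteratedDeriv_iteratedDeriv,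
        hb.eq_of_nhds, if_neg h.ne', add_zero, add_comm]
  rw [hlower] at hcomm
  simp only [hP, mul_add, sum_add_distrib] at hcomm
  rw [hQ, sum_congr rfl htop, sum_add_distrib, sum_ite_eq' (range (n + 1)) p,
    if_pos (mem_range.2 (by omega))] at hcomm
  have hprod : m * deriv (β p) s * iteratedDeriv k f s = 0 := by linarith
  have hm0 : (m : ℝ) ≠ 0 := by exact_mod_cast (by omega : m ≠ 0)
  simpa [hm0, hfk] using hprod

/-- If `P` is a monic differential operator of order `m ≥ 1` with vanishing second highest
coefficient and smooth coefficients on the open interval `I`, and `Q` is a differential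
operator of order `n ≥ 1` with smooth coefficients on `I` commuting with `P`, then the two
highest coefficients `β n` and `β (n-1)` of `Q` are constant on `I`. -/
theorem statement2
    (a₀ b₀ : ℝ) (I : Set ℝ) (hI : I = Set.Ioo a₀ b₀)
    (m n : ℕ) (hm : 1 ≤ m) (hn : 1 ≤ n)
    (α β : ℕ → ℝ → ℝ)
    (hα : ∀ i, i ≤ m - 2 → ∀ t ∈ I, ContDiffAt ℝ (⊤ : ℕ∞) (α i) t)
    (hβ : ∀ j, j ≤ n → ∀ t ∈ I, ContDiffAt ℝ (⊤ : ℕ∞) (β j) t)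
    (P Q : (ℝ → ℝ) → ℝ → ℝ)
    (hP : ∀ f t, P f t
      = iteratedDeriv m f t + ∑ i ∈ Finset.range (m - 1), α i t * iteratedDeriv i f t)
    (hQ : ∀ f t, Q f t = ∑ j ∈ Finset.range (n + 1), β j t * iteratedDeriv j f t)
    (hcomm : ∀ f : ℝ → ℝ, (∀ t ∈ I, ContDiffAt ℝ (⊤ : ℕ∞) f t) →
      ∀ t ∈ I, P (Q f) t = Q (P f) t) :
    (∃ b : ℝ, ∀ t ∈ I, β n t = b) ∧ (∃ c : ℝ, ∀ t ∈ I, β (n - 1) t = c) := by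
  have hopen : IsOpen I := hI ▸ isOpen_Ioo
  have hconn : IsPreconnected I := hI ▸ isPreconnected_Ioo
  have main : ∀ p, p ≤ n → n ≤ p + 1 → (∀ j, p < j → j ≤ n → ∃ b, ∀ t ∈ I, β j t = b) →
      ∃ b, ∀ t ∈ I, β p t = b := by
    intro p hpn hnp hconst
    refine hopen.exists_is_const_of_deriv_eq_zero hconn
      (fun t ht => ((hβ p hpn t ht).differentiableAt (by simp)).differentiableWithinAt) ?_
    intro s hs
    have hf : ContDiff ℝ (⊤ : ℕ∞) (fun t : ℝ => (t - s) ^ (m + p - 1)) := by fun_prop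
    have hc := hcomm _ (fun t _ => hf.contDiffAt) s hs
    rw [hP, hQ, funext (hP _), funext (hQ _)] at hc
    refine deriv_coeff_eq_zero_of_commute_at (k := m + p - 1) hm hpn hnp (by omega)
      (fun i hi => hα i (by omega) s hs) (fun j hj => hβ j hj s hs) ?_ hf ?_ ?_ hc
    · intro j hpj hjn
      obtain ⟨b, hb⟩ := hconst j hpj hjn
      exact ⟨b, Filter.mem_of_superset (hopen.mem_nhds hs) hb⟩
    · intro r hr
      rw [iteratedDeriv_sub_const_pow_self, if_neg hr.ne]
    · rw [iteratedDeriv_sub_const_pow_self, if_pos rfl]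
      exact_mod_cast Nat.factorial_ne_zero _
  have hn_const := main n le_rfl (by omega) fun j h₁ h₂ => by omega
  refine ⟨hn_const, main (n - 1) (by omega) (by omega) fun j h₁ h₂ => ?_⟩
  obtain rfl : j = n := by omega
  exact hn_const
end

section
/- Let N ⊆ ℕ be a set whose complement ℕ ∖ N is finite, and let d ∈ ℕ. Assume that x + d ∈ N for every x ∈ N. Then the set N ∖ {x + d : x ∈ N} is finite and has exactly d elements. -/
theorem compl_image_add_right_nat (N : Set ℕ) (d : ℕ) :
    ((· + d) '' N)ᶜ = Set.Iio d ∪ (· + d) '' Nᶜ := by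
  ext y
  simp only [Set.mem_compl_iff, Set.mem_image, Set.mem_union, Set.mem_Iio]
  constructor
  · intro hy
    by_cases hyd : y < d
    · exact Or.inl hyd
    · exact Or.inr ⟨y - d, fun hm => hy ⟨y - d, hm, by omega⟩, by omega⟩
  · rintro (hy | ⟨x, hx, rfl⟩) ⟨z, hz, hzy⟩
    · omega
    · exact hx (Nat.add_right_cancel hzy ▸ hz)

/-- Combinatorial core of Lemma 2.5: if `N ⊆ ℕ` has finite complement and is closed under
translation by `d`, then `N \ (N + d)` is finite with exactly `d` elements. -/
theorem statement5
    (N : Set ℕ) (hN : Nᶜ.Finite) (d : ℕ) (h : ∀ x ∈ N, x + d ∈ N) :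
    (N \ ((· + d) '' N)).Finite ∧ (N \ ((· + d) '' N)).ncard = d := by
  have hfin : ((· + d) '' N)ᶜ.Finite := by
    rw [compl_image_add_right_nat]
    exact (Set.finite_Iio d).union (hN.image _)
  have hcard : ((· + d) '' N)ᶜ.ncard = d + Nᶜ.ncard := by
    have hdisj : Disjoint (Set.Iio d) ((· + d) '' Nᶜ) := by
      rw [Set.disjoint_left]
      rintro _ hy ⟨x, -, rfl⟩
      simp at hy
    rw [compl_image_add_right_nat,
      Set.ncard_union_eq hdisj (Set.finite_Iio d) (hN.image _),
      Set.ncard_image_of_injective _ (add_left_injective d)]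
    simp [Set.ncard_eq_toFinset_card']
  have hsub : Nᶜ ⊆ ((· + d) '' N)ᶜ :=
    Set.compl_subset_compl.mpr (Set.image_subset_iff.mpr h)
  have hdiff : N \ ((· + d) '' N) = ((· + d) '' N)ᶜ \ Nᶜ := by
    rw [compl_sdiff_compl]
  rw [hdiff]
  refine ⟨hfin.sdiff, ?_⟩
  rw [Set.ncard_sdiff hsub hN, hcard, Nat.add_sub_cancel]
end

section
/- Let m, n ≥ 1 be coprime integers and λ, b ∈ ℂ. Let C be the m×m complex matrix with entries C_{i,j} = 1 if j = i + 1 (for 0 ≤ i ≤ m−2), C_{m−1,0} = λ, and all other entries 0 (the companion matrix of X^m − λ). Then the characteristic polynomial of the matrix b·C^n (the scalar multiple by b of the n-th matrix power of C) equals X^m − b^m·λ^n. -/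
namespace Matrix

open Polynomial

theorem charpoly_eq_of_semiconjBy {ι R : Type*} [Fintype ι] [DecidableEq ι] [CommRing R]
    {W A B : Matrix ι ι R} (hW : IsUnit W) (h : SemiconjBy W A B) : A.charpoly = B.charpoly := by
  obtain ⟨u, rfl⟩ := hW
  have hB : u.val * A * u.val⁻¹ = B := by
    rw [h.eq, mul_assoc, ← coe_units_inv, Units.mul_inv, mul_one]
  rw [← hB, charpoly_units_conj]

theorem charpoly_eq_X_pow_of_isNilpotent {ι R : Type*} [Fintype ι] [DecidableEq ι] [CommRing R]
    [IsDomain R] {A : Matrix ι ι R} (hA : IsNilpotent A) :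
    A.charpoly = X ^ Fintype.card ι :=
  sub_eq_zero.mp (isNilpotent_charpoly_sub_pow_of_isNilpotent hA).eq_zero

theorem isNilpotent_of_strictlyUpperTriangular {m : ℕ} {R : Type*} [CommRing R]
    {A : Matrix (Fin m) (Fin m) R} (hA : ∀ i j, j ≤ i → A i j = 0) : IsNilpotent A := by
  have hchar : A.charpoly = X ^ m := by
    rw [charpoly_of_isUpperTriangular A fun i j hij => hA i j (le_of_lt hij)]
    simp [hA _ _ le_rfl]
  refine ⟨m, ?_⟩
  simpa [hchar] using aeval_self_charpoly A

/-- The rows `(1, v i, v i ^ 2, …)` of a Vandermonde matrix on `m`-th roots of `lam` are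
eigenvectors of the companion matrix of `X ^ m - lam`. -/
theorem semiconjBy_vandermonde_companion {m : ℕ} {R : Type*} [CommRing R] {lam : R}
    {A : Matrix (Fin m) (Fin m) R}
    (hA : ∀ i j : Fin m, A i j =
      if (j : ℕ) = (i : ℕ) + 1 then 1
      else if (i : ℕ) = m - 1 ∧ (j : ℕ) = 0 then lam
      else 0)
    {v : Fin m → R} (hv : ∀ i, v i ^ m = lam) :
    SemiconjBy (vandermonde v) Aᵀ (diagonal v) := by
  ext i j
  rw [diagonal_mul, mul_apply]
  simp only [vandermonde_apply, transpose_apply, hA]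
  rw [← pow_succ']
  by_cases hj : (j : ℕ) + 1 < m
  · rw [Finset.sum_eq_single ⟨(j : ℕ) + 1, hj⟩]
    · simp
    · intro k _ hk
      have hk' : (k : ℕ) ≠ j + 1 := fun h => hk (Fin.ext h)
      rw [if_neg hk', if_neg (by omega), mul_zero]
    · simp
  · have hjm : (j : ℕ) + 1 = m := by omega
    rw [Finset.sum_eq_single ⟨0, by omega⟩]
    · rw [hjm, hv, if_neg (by simp; omega), if_pos ⟨by omega, rfl⟩, pow_zero, one_mul]
    · intro k _ hk
      have hk' : (k : ℕ) ≠ 0 := fun h => hk (Fin.ext h)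
      rw [if_neg (by omega), if_neg (by omega), mul_zero]
    · simp

end Matrix

/-- The "free case" computation in the proof of Theorem 3.1: if `C` is the companion matrix
of `X^m - λ` and `gcd(m,n) = 1`, then the characteristic polynomial of `b·C^n` equals
`X^m - b^m·λ^n`. -/
theorem statement7
    (m n : ℕ) (hm : 1 ≤ m) (hn : 1 ≤ n) (hmn : Nat.Coprime m n)
    (lam b : ℂ)
    (C : Matrix (Fin m) (Fin m) ℂ)
    (hC : ∀ i j : Fin m, C i j =
      if (j : ℕ) = (i : ℕ) + 1 then 1
      else if (i : ℕ) = m - 1 ∧ (j : ℕ) = 0 then lam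
      else 0) :
    Matrix.charpoly (b • C ^ n) = Polynomial.X ^ m - Polynomial.C (b ^ m * lam ^ n) := by
  rcases eq_or_ne lam 0 with rfl | hlam
  · have hnil : IsNilpotent C := Matrix.isNilpotent_of_strictlyUpperTriangular fun i j hij => by
      have hij' : (j : ℕ) ≤ i := hij
      rw [hC, if_neg (by omega), ite_self]
    rw [Matrix.charpoly_eq_X_pow_of_isNilpotent ((hnil.pow_of_pos (by omega)).smul b)]
    simp [zero_pow (show n ≠ 0 by omega)]
  · have hm0 : m ≠ 0 := by omega
    obtain ⟨a, ha⟩ := IsAlgClosed.exists_pow_nat_eq lam hm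
    have ha0 : a ≠ 0 := by
      rintro rfl
      exact hlam (by rw [← ha, zero_pow hm0])
    obtain ⟨ζ, hζ⟩ : ∃ ζ : ℂ, IsPrimitiveRoot ζ m := ⟨_, Complex.isPrimitiveRoot_exp m hm0⟩
    set v : Fin m → ℂ := fun i => ζ ^ (i : ℕ) * a with hv
    have hvm (i : Fin m) : v i ^ m = lam := by
      rw [hv, mul_pow, ha, pow_right_comm, hζ.pow_eq_one, one_pow, one_mul]
    have hinj : Function.Injective v := fun i j hij =>
      Fin.ext (hζ.pow_inj i.2 j.2 (mul_right_cancel₀ ha0 hij))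
    have hW : IsUnit (Matrix.vandermonde v) :=
      (Matrix.isUnit_iff_isUnit_det _).mpr
        (isUnit_iff_ne_zero.mpr (Matrix.det_vandermonde_ne_zero_iff.mpr hinj))
    have hconj : SemiconjBy (Matrix.vandermonde v) (b • C ^ n).transpose
        (Matrix.diagonal (b • v ^ n)) := by
      have hpow := ((Matrix.semiconjBy_vandermonde_companion hC hvm).pow_right n).eq
      rw [SemiconjBy, Matrix.transpose_smul, Matrix.transpose_pow, Matrix.diagonal_smul,
        ← Matrix.diagonal_pow, mul_smul_comm, hpow, smul_mul_assoc]
    rw [← Matrix.charpoly_transpose, Matrix.charpoly_eq_of_semiconjBy hW hconj,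
      Matrix.charpoly_diagonal,
      X_pow_sub_C_eq_prod (hζ.pow_of_coprime n hmn.symm) hm
        (show (b * a ^ n) ^ m = b ^ m * lam ^ n by rw [mul_pow, pow_right_comm, ha]),
      ← Fin.prod_univ_eq_prod_range
        (fun i => Polynomial.X - Polynomial.C ((ζ ^ n) ^ i * (b * a ^ n)))]
    refine Finset.prod_congr rfl fun i _ => ?_
    congr 2
    simp only [hv, Pi.smul_apply, Pi.pow_apply, smul_eq_mul]
    ring
end

section
/- Let I ⊆ ℝ be an open interval, m ≥ 1, and let U, V : ℝ → M be functions with values in the m×m complex matrices M. Assume V is differentiable at every point of I and satisfies the Lax equation V'(t) = U(t)·V(t) − V(t)·U(t) for all t ∈ I. Then the characteristic polynomial of V(t) is independent of t; that is, for all s, t ∈ I the characteristic polynomials of V(s) and V(t) coincide. -/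
/-- **Jacobi's formula** for the derivative of the determinant of a matrix-valued function. -/
theorem HasDerivAt.matrix_det {n 𝕜 A : Type*} [Fintype n] [DecidableEq n]
    [NontriviallyNormedField 𝕜] [NormedCommRing A] [NormedAlgebra 𝕜 A]
    {W : 𝕜 → Matrix n n A} {W' : Matrix n n A} {t : 𝕜}
    (hW : ∀ i j, HasDerivAt (fun s => W s i j) (W' i j) t) :
    HasDerivAt (fun s => (W s).det) ((W t).adjugate * W').trace t := by
  have hsum : HasDerivAt (fun s => ∑ σ : Equiv.Perm n,
      ((Equiv.Perm.sign σ : ℤ) : A) * ∏ i, W s (σ i) i)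
      (∑ σ : Equiv.Perm n, ((Equiv.Perm.sign σ : ℤ) : A) *
        ∑ i, (∏ j ∈ Finset.univ.erase i, W t (σ j) j) • W' (σ i) i) t :=
    HasDerivAt.fun_sum fun σ _ =>
      (HasDerivAt.fun_finsetProd fun i _ => hW (σ i) i).const_mul _
  simp only [Matrix.det_apply']
  convert hsum using 1
  have hdiag (i : n) : ((W t).adjugate * W') i i =
      ((W t).updateCol i (fun k => W' k i)).det := by
    rw [← Matrix.cramer_apply, Matrix.cramer_eq_adjugate_mulVec]
    rfl
  simp only [Matrix.trace, Matrix.diag_apply, hdiag, Matrix.det_apply', Finset.mul_sum]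
  rw [Finset.sum_comm]
  refine Finset.sum_congr rfl fun σ _ => Finset.sum_congr rfl fun i _ => ?_
  rw [← Finset.prod_erase_mul _ _ (Finset.mem_univ i), Matrix.updateCol_self, smul_eq_mul]
  congr 2
  exact Finset.prod_congr rfl fun j hj => Matrix.updateCol_ne (Finset.ne_of_mem_erase hj)

/-- The adjugate of a matrix is trace-orthogonal to every commutator with that matrix. -/
theorem Matrix.trace_adjugate_mul_commutator {n R : Type*} [Fintype n] [DecidableEq n]
    [CommRing R] (W U : Matrix n n R) : (W.adjugate * (U * W - W * U)).trace = 0 := by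
  rw [mul_sub, Matrix.trace_sub, ← mul_assoc, Matrix.trace_mul_comm, ← mul_assoc, ← mul_assoc,
    Matrix.mul_adjugate, Matrix.adjugate_mul, sub_self]

/-- Isospectrality in the proof of Theorem 3.1: if the matrix-valued function `V` satisfies
the Lax equation `V' = UV - VU` (entrywise) on the open interval `I`, then the characteristic
polynomial of `V(t)` is independent of `t ∈ I`. -/
theorem statement8
    (a₀ b₀ : ℝ) (I : Set ℝ) (hI : I = Set.Ioo a₀ b₀)
    (m : ℕ) (hm : 1 ≤ m)
    (U V : ℝ → Matrix (Fin m) (Fin m) ℂ)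
    (hV : ∀ t ∈ I, ∀ i j : Fin m,
      HasDerivAt (fun s => V s i j) ((U t * V t - V t * U t) i j) t) :
    ∀ s ∈ I, ∀ t ∈ I, Matrix.charpoly (V s) = Matrix.charpoly (V t) := by
  subst hI
  intro s hs t ht
  refine Polynomial.funext fun μ => ?_
  simp only [Matrix.eval_charpoly]
  have hderiv : ∀ x ∈ Set.Ioo a₀ b₀,
      HasDerivAt (fun x => (Matrix.scalar (Fin m) μ - V x).det) 0 x := by
    intro x hx
    rw [← Matrix.trace_adjugate_mul_commutator (Matrix.scalar (Fin m) μ - V x) (U x)]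
    refine HasDerivAt.matrix_det fun i j => ?_
    have hcomm : U x * (Matrix.scalar (Fin m) μ - V x) - (Matrix.scalar (Fin m) μ - V x) * U x =
        -(U x * V x - V x * U x) := by
      rw [mul_sub, sub_mul, (Matrix.scalar_commute μ (Commute.all μ) (U x)).eq]
      abel
    rw [hcomm]
    exact (hV x hx i j).const_sub _
  exact isOpen_Ioo.is_const_of_deriv_eq_zero isPreconnected_Ioo
    (fun x hx => (hderiv x hx).differentiableAt.differentiableWithinAt)
    (fun x hx => (hderiv x hx).deriv) hs ht
end

section
/- Let U ⊆ ℂ be an open connected set and m, n ≥ 1 integers with gcd(m,n) = 1. Let P be the differential operator Pf = f^{(m)} + Σ_{i=0}^{m−1} α_i·f^{(i)} with α_0,…,α_{m−1} holomorphic on U, and let Q be the differential operator Qf = b·f^{(n)} + Σ_{j=0}^{n−1} β_j·f^{(j)} with b ∈ ℂ, b ≠ 0, and β_0,…,β_{n−1} holomorphic on U, and assume P and Q commute. Let R and S be differential operators with holomorphic coefficients on U (each of some finite order) such that R commutes with both P and Q, and S commutes with both P and Q. Then R and S commute with each other: R(Sf)(z) = S(Rf)(z) for every f holomorphic on U and every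 z ∈ U. -/
open scoped BigOperators

/-- Two differential operators `A`, `B` with holomorphic coefficients on `U` commute if
`A(Bf) = B(Af)` on `U` for every function `f` holomorphic on `U`. -/
def CommuteOn (U : Set ℂ) (A B : (ℂ → ℂ) → ℂ → ℂ) : Prop :=
  ∀ f : ℂ → ℂ, (∀ z ∈ U, DifferentiableAt ℂ f z) → ∀ z ∈ U, A (B f) z = B (A f) z

namespace DiffOp

variable {𝕜 H : Type*} [Field 𝕜] [CommRing H] [Algebra 𝕜 H] (D : Derivation 𝕜 H H)

/-- The differential operators of order less than `k` for the derivation `D`. -/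
def orderLT (k : ℕ) : Submodule H (Module.End 𝕜 H) :=
  Submodule.span H {T | ∃ i < k, T = (D : Module.End 𝕜 H) ^ i}

/-- `T` is a differential operator of order at most `k` whose coefficient of `D ^ k` is `a`. -/
def HasSymbol (k : ℕ) (a : H) (T : Module.End 𝕜 H) : Prop :=
  T - a • (D : Module.End 𝕜 H) ^ k ∈ orderLT D k

variable {D} {k l : ℕ} {a b : H} {T T' : Module.End 𝕜 H}

lemma pow_mem_orderLT {i : ℕ} (h : i < k) : (D : Module.End 𝕜 H) ^ i ∈ orderLT D k :=
  Submodule.subset_span ⟨i, h, rfl⟩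

lemma orderLT_mono (h : k ≤ l) : orderLT D k ≤ orderLT D l :=
  Submodule.span_mono fun _ ⟨i, hi, hT⟩ => ⟨i, hi.trans_le h, hT⟩

lemma orderLT_induction {p : Module.End 𝕜 H → Prop}
    (hpow : ∀ i < k, p ((D : Module.End 𝕜 H) ^ i)) (hzero : p 0)
    (hadd : ∀ T T', p T → p T' → p (T + T')) (hsmul : ∀ (a : H) T, p T → p (a • T))
    (hT : T ∈ orderLT D k) : p T := by
  refine Submodule.span_induction (p := fun T _ => p T) ?_ hzero
    (fun _ _ _ _ => hadd _ _) (fun _ _ _ => hsmul _ _) hT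
  rintro _ ⟨i, hi, rfl⟩
  exact hpow i hi

@[simp] lemma orderLT_zero : orderLT D 0 = ⊥ := by
  simp [orderLT]

lemma HasSymbol.mem (h : HasSymbol D k a T) : T ∈ orderLT D (k + 1) := by
  have := add_mem (orderLT_mono k.le_succ h)
    ((orderLT D (k + 1)).smul_mem a (pow_mem_orderLT k.lt_succ_self))
  simpa using this

lemma HasSymbol.add (h : HasSymbol D k a T) (h' : HasSymbol D k b T') :
    HasSymbol D k (a + b) (T + T') := by
  have := add_mem h h'
  rw [HasSymbol, add_smul]
  convert this using 1
  abel

lemma HasSymbol.smul (c : H) (h : HasSymbol D k a T) : HasSymbol D k (c * a) (c • T) := by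
  have := (orderLT D k).smul_mem c h
  rwa [smul_sub, smul_smul] at this

lemma HasSymbol.sub (h : HasSymbol D k a T) (h' : HasSymbol D k b T') :
    HasSymbol D k (a - b) (T - T') := by
  have := sub_mem h h'
  have hsub : (a - b) • (D : Module.End 𝕜 H) ^ k =
      a • (D : Module.End 𝕜 H) ^ k - b • (D : Module.End 𝕜 H) ^ k := by
    ext x
    simp [sub_mul]
  rw [HasSymbol, hsub]
  convert this using 1
  abel

lemma hasSymbol_zero_iff : HasSymbol D k 0 T ↔ T ∈ orderLT D k := by
  simp [HasSymbol]

lemma hasSymbol_pow_add (h : T ∈ orderLT D k) :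
    HasSymbol D k 1 ((D : Module.End 𝕜 H) ^ k + T) := by
  rwa [HasSymbol, one_smul, add_sub_cancel_left]

lemma exists_hasSymbol (h : T ∈ orderLT D (k + 1)) : ∃ a, HasSymbol D k a T := by
  refine orderLT_induction (p := fun T => ∃ a, HasSymbol D k a T) ?_ ?_ ?_ ?_ h
  · intro i hi
    rcases (Nat.lt_succ_iff_lt_or_eq.1 hi) with hi | rfl
    · exact ⟨0, hasSymbol_zero_iff.2 (pow_mem_orderLT hi)⟩
    · exact ⟨1, by simp [HasSymbol]⟩
  · exact ⟨0, by simp [HasSymbol]⟩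
  · rintro T T' ⟨a, ha⟩ ⟨b, hb⟩
    exact ⟨_, ha.add hb⟩
  · rintro c T ⟨a, ha⟩
    exact ⟨_, ha.smul c⟩

lemma exists_hasSymbol_ne_zero (h : T ∈ orderLT D k) (hT : T ≠ 0) :
    ∃ l < k, ∃ a ≠ 0, HasSymbol D l a T := by
  induction k with
  | zero => simp_all
  | succ k ih =>
    obtain ⟨a, ha⟩ := exists_hasSymbol h
    by_cases h0 : a = 0
    · subst h0
      obtain ⟨l, hl, hl'⟩ := ih (hasSymbol_zero_iff.1 ha)
      exact ⟨l, hl.trans k.lt_succ_self, hl'⟩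
    · exact ⟨k, k.lt_succ_self, a, h0, ha⟩

lemma derivation_mul_smul (a : H) (T : Module.End 𝕜 H) :
    (D : Module.End 𝕜 H) * (a • T) = D a • T + a • ((D : Module.End 𝕜 H) * T) := by
  ext x
  simp [add_comm, mul_comm]

lemma smul_mul (a : H) (T T' : Module.End 𝕜 H) : (a • T) * T' = a • (T * T') := rfl

lemma derivation_mul_mem (h : T ∈ orderLT D k) :
    (D : Module.End 𝕜 H) * T ∈ orderLT D (k + 1) := by
  suffices T ∈ orderLT D k ∧ (D : Module.End 𝕜 H) * T ∈ orderLT D (k + 1) from this.2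
  refine orderLT_induction (p := fun T => T ∈ orderLT D k ∧
    (D : Module.End 𝕜 H) * T ∈ orderLT D (k + 1)) ?_ ?_ ?_ ?_ h
  · intro i hi
    rw [← pow_succ']
    exact ⟨pow_mem_orderLT hi, pow_mem_orderLT (by omega)⟩
  · simp
  · rintro T T' ⟨h1, h2⟩ ⟨h3, h4⟩
    rw [mul_add]
    exact ⟨add_mem h1 h3, add_mem h2 h4⟩
  · rintro a T ⟨h1, h2⟩
    rw [derivation_mul_smul]
    exact ⟨Submodule.smul_mem _ _ h1,
      add_mem (Submodule.smul_mem _ _ (orderLT_mono k.le_succ h1)) (Submodule.smul_mem _ _ h2)⟩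

lemma HasSymbol.derivation_mul (h : HasSymbol D k a T) :
    HasSymbol D (k + 1) a ((D : Module.End 𝕜 H) * T) := by
  have h1 := derivation_mul_mem h
  rw [mul_sub, derivation_mul_smul, ← pow_succ'] at h1
  have h2 := add_mem h1 ((orderLT D (k + 1)).smul_mem (D a) (pow_mem_orderLT k.lt_succ_self))
  rw [HasSymbol]
  convert h2 using 1
  abel

lemma HasSymbol.pow_mul (h : HasSymbol D l b T) (i : ℕ) :
    HasSymbol D (i + l) b ((D : Module.End 𝕜 H) ^ i * T) := by
  induction i with
  | zero => simpa using h
  | succ i ih =>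
    rw [pow_succ', mul_assoc, Nat.succ_add]
    exact ih.derivation_mul

lemma mul_mem (hT : T ∈ orderLT D k) (hT' : T' ∈ orderLT D (l + 1)) :
    T * T' ∈ orderLT D (k + l) := by
  obtain ⟨b, hb⟩ := exists_hasSymbol hT'
  refine orderLT_induction (p := fun T => T * T' ∈ orderLT D (k + l)) ?_ ?_ ?_ ?_ hT
  · intro i hi
    exact orderLT_mono (by omega) (hb.pow_mul i).mem
  · simp
  · intro T₁ T₂ h1 h2
    rw [add_mul]
    exact add_mem h1 h2
  · intro a T h
    rw [smul_mul]
    exact Submodule.smul_mem _ _ h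

lemma HasSymbol.mul (h : HasSymbol D k a T) (h' : HasSymbol D l b T') :
    HasSymbol D (k + l) (a * b) (T * T') := by
  have h1 := mul_mem h h'.mem
  have h2 := add_mem h1 ((h'.pow_mul k).smul a)
  rw [HasSymbol]
  convert h2 using 1
  rw [sub_mul, smul_mul]
  abel

lemma hasSymbol_one : HasSymbol D 0 1 (1 : Module.End 𝕜 H) := by
  simp [HasSymbol]

lemma HasSymbol.pow (h : HasSymbol D k a T) (j : ℕ) : HasSymbol D (j * k) (a ^ j) (T ^ j) := by
  induction j with
  | zero => simpa using hasSymbol_one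
  | succ j ih =>
    rw [pow_succ, pow_succ, Nat.succ_mul]
    exact ih.mul h

lemma HasSymbol.commutator_mem (h : HasSymbol D k a T) (h' : HasSymbol D l b T') :
    T * T' - T' * T ∈ orderLT D (k + l) := by
  have := (h.mul h').sub (add_comm k l ▸ h'.mul h)
  rwa [mul_comm b a, sub_self, hasSymbol_zero_iff] at this

lemma derivation_commutator_mem (h : T ∈ orderLT D k) :
    (D : Module.End 𝕜 H) * T - T * (D : Module.End 𝕜 H) ∈ orderLT D k := by
  suffices T ∈ orderLT D k ∧
    (D : Module.End 𝕜 H) * T - T * (D : Module.End 𝕜 H) ∈ orderLT D k from this.2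
  refine orderLT_induction (p := fun T => T ∈ orderLT D k ∧
    (D : Module.End 𝕜 H) * T - T * (D : Module.End 𝕜 H) ∈ orderLT D k) ?_ ?_ ?_ ?_ h
  · intro i hi
    rw [← pow_succ', ← pow_succ, sub_self]
    exact ⟨pow_mem_orderLT hi, zero_mem _⟩
  · simp
  · rintro T T' ⟨h1, h2⟩ ⟨h3, h4⟩
    refine ⟨add_mem h1 h3, ?_⟩
    convert add_mem h2 h4 using 1
    noncomm_ring
  · rintro a T ⟨h1, h2⟩
    refine ⟨Submodule.smul_mem _ _ h1, ?_⟩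
    have h3 := add_mem (Submodule.smul_mem _ (D a) h1) (Submodule.smul_mem _ a h2)
    rwa [smul_sub, ← add_sub_assoc, ← derivation_mul_smul] at h3

lemma HasSymbol.derivation_commutator (h : HasSymbol D k a T) :
    HasSymbol D k (D a) ((D : Module.End 𝕜 H) * T - T * (D : Module.End 𝕜 H)) := by
  have h1 := derivation_commutator_mem h
  rw [mul_sub, sub_mul, derivation_mul_smul, smul_mul, ← pow_succ', ← pow_succ] at h1
  rw [HasSymbol]
  convert h1 using 1
  abel

lemma HasSymbol.pow_commutator (h : HasSymbol D k a T) (m : ℕ) :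
    HasSymbol D (m + k) ((m + 1) * D a)
      ((D : Module.End 𝕜 H) ^ (m + 1) * T - T * (D : Module.End 𝕜 H) ^ (m + 1)) := by
  induction m with
  | zero => simpa using h.derivation_commutator
  | succ m ih =>
    have hD : HasSymbol D 1 1 (D : Module.End 𝕜 H) := by simp [HasSymbol]
    have h1 := ih.mul hD
    have h2 := h.derivation_commutator.pow_mul (m + 1)
    rw [show m + 1 + k = m + k + 1 by omega] at h2 ⊢
    convert h1.add h2 using 1
    · push_cast; ring
    · rw [pow_succ _ (m + 1), sub_mul, mul_sub]; simp only [mul_assoc]; abel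

/-- The commutator of a monic operator of order `m + 1` with an operator of symbol `a`
has symbol `(m + 1) * D a`. -/
lemma HasSymbol.commutator_monic {P : Module.End 𝕜 H} {m : ℕ} (hP : HasSymbol D (m + 1) 1 P)
    (h : HasSymbol D k a T) : HasSymbol D (m + k) ((m + 1) * D a) (P * T - T * P) := by
  obtain ⟨c, hc⟩ := exists_hasSymbol hP
  have h1 := hasSymbol_zero_iff.2 (hc.commutator_mem h)
  convert (h.pow_commutator m).add h1 using 1
  · simp
  · rw [one_smul, sub_mul, mul_sub]; abel

lemma commutator_coordinate {x : H} (hx : D x = 1) (i : ℕ) :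
    (D : Module.End 𝕜 H) ^ (i + 1) * (x • 1) - x • (D : Module.End 𝕜 H) ^ (i + 1) =
      ((i : H) + 1) • (D : Module.End 𝕜 H) ^ i := by
  induction i with
  | zero => simp [derivation_mul_smul, hx]
  | succ i ih =>
    rw [sub_eq_iff_eq_add] at ih ⊢
    rw [pow_succ', mul_assoc, ih, mul_add, derivation_mul_smul, derivation_mul_smul, hx,
      ← pow_succ', ← pow_succ']
    simp only [map_add, Derivation.map_natCast, Derivation.map_one_eq_zero, one_smul]
    push_cast
    module

lemma commutator_coordinate_mem {x : H} (hx : D x = 1) (h : T ∈ orderLT D (k + 1)) :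
    T * (x • 1) - x • T ∈ orderLT D k := by
  refine orderLT_induction (p := fun T => T * (x • 1) - x • T ∈ orderLT D k) ?_ ?_ ?_ ?_ h
  · rintro (_ | i) hi
    · simp
    · rw [commutator_coordinate hx]
      exact Submodule.smul_mem _ _ (pow_mem_orderLT (by omega))
  · simp
  · intro T T' h1 h2
    convert add_mem h1 h2 using 1
    rw [add_mul, smul_add]; abel
  · intro a T h
    convert Submodule.smul_mem _ a h using 1
    rw [smul_mul, smul_sub, smul_comm]

lemma HasSymbol.commutator_coordinate {x : H} (hx : D x = 1) (h : HasSymbol D (k + 1) a T) :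
    HasSymbol D k ((k + 1) * a) (T * (x • 1) - x • T) := by
  have h1 := commutator_coordinate_mem hx h
  rw [sub_mul, smul_mul, sub_eq_iff_eq_add.1 (DiffOp.commutator_coordinate hx k)] at h1
  rw [HasSymbol]
  convert h1 using 1
  module

lemma HasSymbol.commutator_pow {R : Module.End 𝕜 H} (h : HasSymbol D k a T)
    (h' : HasSymbol D l b (R * T - T * R)) (j : ℕ) :
    HasSymbol D (j * k + l) ((j + 1) * (a ^ j * b)) (R * T ^ (j + 1) - T ^ (j + 1) * R) := by
  induction j with
  | zero => simpa using h'
  | succ j ih =>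
    have h1 := ih.mul h
    have h2 := (h.pow (j + 1)).mul h'
    rw [show j * k + l + k = (j + 1) * k + l by ring] at h1
    convert h1.add h2 using 1
    · push_cast; ring
    · rw [pow_succ _ (j + 1), sub_mul, mul_sub]; simp only [mul_assoc]; abel

variable [CharZero H] [IsDomain H]

lemma eq_zero_of_hasSymbol_zero {x : H} (hx : D x = 1)
    (h : HasSymbol D k a (0 : Module.End 𝕜 H)) : a = 0 := by
  induction k generalizing a with
  | zero =>
    have h1 : a • (1 : Module.End 𝕜 H) = 0 := by
      simpa only [HasSymbol, orderLT_zero, Submodule.mem_bot, pow_zero, zero_sub,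
        neg_eq_zero] using h
    simpa using congrArg (fun T : Module.End 𝕜 H => T 1) h1
  | succ k ih =>
    have := ih (by simpa using h.commutator_coordinate hx)
    exact (mul_eq_zero.1 this).resolve_left (by exact_mod_cast k.succ_ne_zero)

lemma HasSymbol.lt_of_mem {x : H} (hx : D x = 1) (ha : a ≠ 0) (h : HasSymbol D k a T)
    (hT : T ∈ orderLT D l) : k < l := by
  by_contra! hl
  have := h.sub (hasSymbol_zero_iff.2 (orderLT_mono hl hT))
  rw [sub_self, sub_zero] at this
  exact ha (eq_zero_of_hasSymbol_zero hx this)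

/-- Passing from `S` to `S ^ m - c • P ^ s`, with `s` the order of `S` and `c` constant,
lowers the order of `S` relative to that of its commutator with `R`. -/
lemma false_of_commutator_hasSymbol {x : H} (hx : D x = 1)
    (hconst : ∀ a : H, D a = 0 → ∃ c : 𝕜, algebraMap 𝕜 H c = a)
    {m : ℕ} {P R : Module.End 𝕜 H} (hP : HasSymbol D (m + 1) 1 P) (hRP : Commute R P)
    {r : ℕ} {e : H} (hR : HasSymbol D r e R) (N : ℕ) :
    ∀ {S : Module.End 𝕜 H} {s t : ℕ} {a b : H}, Commute S P → a ≠ 0 → HasSymbol D s a S →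
      b ≠ 0 → HasSymbol D t b (R * S - S * R) → s + r ≤ t + N → False := by
  induction N with
  | zero =>
    intro S s t a b _ _ hS hb hRS hN
    have := hRS.lt_of_mem hx hb (hR.commutator_mem hS)
    omega
  | succ N ih =>
    intro S s t a b hSP ha hS hb hRS hN
    have hDa : D a = 0 := by
      have h1 := hP.commutator_monic hS
      rw [hSP.eq, sub_self] at h1
      exact (mul_eq_zero.1 (eq_zero_of_hasSymbol_zero hx h1)).resolve_left
        (by exact_mod_cast m.succ_ne_zero)
    obtain ⟨c, rfl⟩ := hconst a hDa
    set X := S ^ (m + 1) - c ^ (m + 1) • P ^ s with hX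
    have hXmem : X ∈ orderLT D ((m + 1) * s) := by
      have h1 := (hS.pow (m + 1)).sub
        (mul_comm s (m + 1) ▸ (hP.pow s).smul (algebraMap 𝕜 H (c ^ (m + 1))))
      rw [one_pow, mul_one, map_pow, sub_self, hasSymbol_zero_iff] at h1
      rwa [hX, ← algebraMap_smul H, map_pow]
    have hXP : Commute X P :=
      (hSP.pow_left _).sub_left (((Commute.refl P).pow_left s).smul_left _)
    have hRX : HasSymbol D (m * s + t) ((m + 1) * (algebraMap 𝕜 H c ^ m * b)) (R * X - X * R) := by
      convert hS.commutator_pow hRS m using 1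
      have : Commute R (c ^ (m + 1) • P ^ s) := (hRP.pow_right s).smul_right _
      rw [hX, mul_sub, sub_mul, this.eq]
      abel
    have hb' : ((m : H) + 1) * (algebraMap 𝕜 H c ^ m * b) ≠ 0 :=
      mul_ne_zero (by exact_mod_cast m.succ_ne_zero) (mul_ne_zero (pow_ne_zero _ ha) hb)
    have hX0 : X ≠ 0 := by
      rintro h0
      rw [h0, mul_zero, zero_mul, sub_self] at hRX
      exact hb' (eq_zero_of_hasSymbol_zero hx hRX)
    obtain ⟨s', hs', a', ha', hXs⟩ := exists_hasSymbol_ne_zero hXmem hX0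
    refine ih hXP ha' hXs hb' hRX ?_
    rw [Nat.succ_mul] at hs'
    omega

/-- Differential operators commuting with a monic differential operator of positive order
commute with each other. -/
theorem commute_of_commute_monic {x : H} (hx : D x = 1)
    (hconst : ∀ a : H, D a = 0 → ∃ c : 𝕜, algebraMap 𝕜 H c = a)
    {m : ℕ} {P R S : Module.End 𝕜 H} (hP : HasSymbol D (m + 1) 1 P)
    (hR : R ∈ orderLT D (k + 1)) (hS : S ∈ orderLT D (l + 1))
    (hRP : Commute R P) (hSP : Commute S P) : Commute R S := by
  by_contra hne
  obtain ⟨e, hR⟩ := exists_hasSymbol hR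
  have hS0 : S ≠ 0 := by
    rintro rfl
    exact hne (Commute.zero_right R)
  obtain ⟨s, -, a, ha, hSs⟩ := exists_hasSymbol_ne_zero hS hS0
  obtain ⟨t, -, b, hb, hRS⟩ := exists_hasSymbol_ne_zero (hR.commutator_mem hSs)
    (fun h => hne (sub_eq_zero.1 h))
  exact false_of_commutator_hasSymbol hx hconst hP hRP hR (s + k) hSP ha hSs hb hRS (by omega)

end DiffOp

/-- The algebra of holomorphic functions on `U`, as functions on the subtype. -/
def holomorphicSubalgebra (U : Set ℂ) : Subalgebra ℂ (U → ℂ) where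
  carrier := {g | ∃ f : ℂ → ℂ, DifferentiableOn ℂ f U ∧ ∀ z : U, g z = f z}
  mul_mem' := by
    rintro _ _ ⟨f, hf, h⟩ ⟨f', hf', h'⟩
    exact ⟨fun z => f z * f' z, hf.mul hf', fun z => by simp [h, h']⟩
  add_mem' := by
    rintro _ _ ⟨f, hf, h⟩ ⟨f', hf', h'⟩
    exact ⟨fun z => f z + f' z, hf.add hf', fun z => by simp [h, h']⟩
  algebraMap_mem' c := ⟨fun _ => c, differentiableOn_const c, fun _ => rfl⟩

namespace holomorphicSubalgebra

variable {U : Set ℂ}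

/-- The restriction to `U` of a function holomorphic on `U`. -/
def restrict (f : ℂ → ℂ) (hf : DifferentiableOn ℂ f U) : holomorphicSubalgebra U :=
  ⟨fun z => f z, f, hf, fun _ => rfl⟩

lemma restrict_apply {f : ℂ → ℂ} (hf : DifferentiableOn ℂ f U) (z : U) :
    (restrict f hf : U → ℂ) z = f z := rfl

lemma exists_restrict_eq (g : holomorphicSubalgebra U) : ∃ f hf, restrict f hf = g := by
  obtain ⟨g, f, hf, h⟩ := g
  exact ⟨f, hf, Subtype.ext (funext fun z => (h z).symm)⟩

/-- An extension to `ℂ` of a holomorphic function on `U`. -/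
noncomputable def extend (g : holomorphicSubalgebra U) : ℂ → ℂ := (exists_restrict_eq g).choose

lemma differentiableOn_extend (g : holomorphicSubalgebra U) : DifferentiableOn ℂ (extend g) U :=
  (exists_restrict_eq g).choose_spec.choose

lemma extend_apply (g : holomorphicSubalgebra U) (z : U) : extend g z = (g : U → ℂ) z :=
  congrFun (congrArg Subtype.val (exists_restrict_eq g).choose_spec.choose_spec) z

lemma deriv_extend_eq (hU : IsOpen U) {g : holomorphicSubalgebra U} {f : ℂ → ℂ}
    (h : ∀ z : U, (g : U → ℂ) z = f z) {z : ℂ} (hz : z ∈ U) :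
    deriv (extend g) z = deriv f z := by
  refine Filter.EventuallyEq.deriv_eq ?_
  filter_upwards [hU.mem_nhds hz] with w hw
  exact (extend_apply g ⟨w, hw⟩).trans (h ⟨w, hw⟩)

/-- Complex differentiation on the algebra of holomorphic functions on an open set. -/
noncomputable def derivation (hU : IsOpen U) :
    Derivation ℂ (holomorphicSubalgebra U) (holomorphicSubalgebra U) :=
  Derivation.mk'
    { toFun g := restrict (deriv (extend g)) ((differentiableOn_extend g).deriv hU)
      map_add' g g' := by
        refine Subtype.ext (funext fun z => ?_)
        have hd g := (differentiableOn_extend g).differentiableAt (hU.mem_nhds z.2)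
        exact (deriv_extend_eq hU (f := extend g + extend g')
          (fun w => by simp [extend_apply]) z.2).trans (deriv_add (hd g) (hd g'))
      map_smul' c g := by
        refine Subtype.ext (funext fun z => ?_)
        have hd g := (differentiableOn_extend g).differentiableAt (hU.mem_nhds z.2)
        exact (deriv_extend_eq hU (f := c • extend g)
          (fun w => by simp [extend_apply]) z.2).trans (deriv_const_smul c (hd g)) }
    fun g g' => by
      refine Subtype.ext (funext fun z => ?_)
      have hd g := (differentiableOn_extend g).differentiableAt (hU.mem_nhds z.2)
      refine (deriv_extend_eq hU (f := extend g * extend g')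
        (fun w => by simp [extend_apply]) z.2).trans ((deriv_mul (hd g) (hd g')).trans ?_)
      simp only [extend_apply]
      change _ = (g : U → ℂ) z * deriv (extend g') z + (g' : U → ℂ) z * deriv (extend g) z
      ring

lemma derivation_restrict (hU : IsOpen U) {f : ℂ → ℂ} (hf : DifferentiableOn ℂ f U) :
    derivation hU (restrict f hf) = restrict (deriv f) (hf.deriv hU) :=
  Subtype.ext (funext fun z => deriv_extend_eq hU (fun _ => rfl) z.2)

lemma differentiableOn_iteratedDeriv (hU : IsOpen U) {f : ℂ → ℂ} (hf : DifferentiableOn ℂ f U)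
    (i : ℕ) : DifferentiableOn ℂ (iteratedDeriv i f) U := by
  induction i with
  | zero => simpa using hf
  | succ i ih => simpa [iteratedDeriv_succ] using ih.deriv hU

lemma derivation_pow_restrict (hU : IsOpen U) {f : ℂ → ℂ} (hf : DifferentiableOn ℂ f U) (i : ℕ) :
    ((derivation hU : Module.End ℂ (holomorphicSubalgebra U)) ^ i) (restrict f hf) =
      restrict (iteratedDeriv i f) (differentiableOn_iteratedDeriv hU hf i) := by
  induction i with
  | zero => simp
  | succ i ih =>
    rw [pow_succ', Module.End.mul_apply, ih]
    simp only [iteratedDeriv_succ]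
    exact derivation_restrict hU _

lemma isDomain (hU : IsOpen U) (hU' : IsConnected U) : IsDomain (holomorphicSubalgebra U) := by
  have : Nonempty U := hU'.nonempty.to_subtype
  have : NoZeroDivisors (holomorphicSubalgebra U) := by
    refine ⟨fun {g g'} h => ?_⟩
    have h1 := ((differentiableOn_extend g).analyticOnNhd hU).eq_zero_or_eq_zero_of_mul_eq_zero
      ((differentiableOn_extend g').analyticOnNhd hU) (fun z hz => by
        simpa [extend_apply _ ⟨z, hz⟩] using congrFun (congrArg Subtype.val h) ⟨z, hz⟩)
      hU'.isPreconnected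
    refine h1.imp (fun h => ?_) (fun h => ?_) <;>
    · refine Subtype.ext (funext fun z => ?_)
      rw [← extend_apply]
      exact h z z.2
  exact NoZeroDivisors.to_isDomain _

lemma exists_algebraMap_eq (hU : IsOpen U) (hU' : IsConnected U) {g : holomorphicSubalgebra U}
    (hg : derivation hU g = 0) : ∃ c : ℂ, algebraMap ℂ (holomorphicSubalgebra U) c = g := by
  obtain ⟨c, hc⟩ := hU.exists_is_const_of_deriv_eq_zero hU'.isPreconnected
    (differentiableOn_extend g) (fun z hz => congrFun (congrArg Subtype.val hg) ⟨z, hz⟩)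
  exact ⟨c, Subtype.ext (funext fun z => ((extend_apply g z).symm.trans (hc z z.2)).symm)⟩

lemma derivation_coordinate (hU : IsOpen U) :
    derivation hU (restrict (fun z => z) differentiableOn_id) = 1 := by
  rw [derivation_restrict]
  exact Subtype.ext (funext fun z => deriv_id (z : ℂ))

/-- `T` acts on holomorphic functions on `U` as the operator `A`. -/
def Represents (T : Module.End ℂ (holomorphicSubalgebra U)) (A : (ℂ → ℂ) → ℂ → ℂ) : Prop :=
  ∀ f hf, ∀ z : U, (T (restrict f hf) : U → ℂ) z = A f z

lemma Represents.differentiableOn {T : Module.End ℂ (holomorphicSubalgebra U)}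
    {A : (ℂ → ℂ) → ℂ → ℂ} (h : Represents T A) {f : ℂ → ℂ} (hf : DifferentiableOn ℂ f U) :
    DifferentiableOn ℂ (A f) U :=
  (differentiableOn_extend (T (restrict f hf))).congr fun z hz =>
    ((extend_apply _ ⟨z, hz⟩).trans (h f hf ⟨z, hz⟩)).symm

lemma Represents.mul {T T' : Module.End ℂ (holomorphicSubalgebra U)}
    {A A' : (ℂ → ℂ) → ℂ → ℂ} (h : Represents T A) (h' : Represents T' A') :
    Represents (T * T') (fun f => A (A' f)) := by
  intro f hf z
  have : T' (restrict f hf) = restrict (A' f) (h'.differentiableOn hf) :=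
    Subtype.ext (funext (h' f hf))
  rw [Module.End.mul_apply, this]
  exact h _ _ z

lemma Represents.commute_iff (hU : IsOpen U) {T T' : Module.End ℂ (holomorphicSubalgebra U)}
    {A A' : (ℂ → ℂ) → ℂ → ℂ} (h : Represents T A) (h' : Represents T' A') :
    Commute T T' ↔ CommuteOn U A A' := by
  constructor
  · intro hc f hf z hz
    have hf' : DifferentiableOn ℂ f U := fun w hw => (hf w hw).differentiableWithinAt
    refine (h.mul h' f hf' ⟨z, hz⟩).symm.trans ?_
    rw [hc.eq]
    exact h'.mul h f hf' ⟨z, hz⟩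
  · intro hc
    refine LinearMap.ext fun g => ?_
    obtain ⟨f, hf, rfl⟩ := exists_restrict_eq g
    refine Subtype.ext (funext fun z => ?_)
    rw [h.mul h' f hf z, h'.mul h f hf z]
    exact hc f (fun w hw => hf.differentiableAt (hU.mem_nhds hw)) z z.2

/-- The operator `∑ i < k, a i • d ^ i / dz ^ i` is represented by an element of order less
than `k`. -/
lemma exists_represents (hU : IsOpen U) {k : ℕ} {a : ℕ → ℂ → ℂ}
    (ha : ∀ i < k, ∀ z ∈ U, DifferentiableAt ℂ (a i) z) :
    ∃ T ∈ DiffOp.orderLT (derivation hU) k,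
      Represents T fun f z => ∑ i ∈ Finset.range k, a i z * iteratedDeriv i f z := by
  have ha' (i : Fin k) : DifferentiableOn ℂ (a i) U :=
    fun z hz => (ha i i.2 z hz).differentiableWithinAt
  refine ⟨∑ i : Fin k, restrict (a i) (ha' i) •
    (derivation hU : Module.End ℂ (holomorphicSubalgebra U)) ^ (i : ℕ),
    Submodule.sum_mem _ fun i _ => Submodule.smul_mem _ _ (DiffOp.pow_mem_orderLT i.2), ?_⟩
  intro f hf z
  dsimp only
  rw [Finset.sum_range (fun i => a i z * iteratedDeriv i f z)]
  simp [derivation_pow_restrict, restrict_apply]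

end holomorphicSubalgebra

open holomorphicSubalgebra in
/-- Commutativity of the centraliser (Lemma 3.3): if `P` and `Q` are commuting differential
operators of coprime orders `m` and `n` with holomorphic coefficients on the open connected
set `U ⊆ ℂ` (with `P` monic and `Q` of constant nonzero highest coefficient `b`), then any
two differential operators `R`, `S` with holomorphic coefficients on `U`, each commuting
with both `P` and `Q`, commute with each other. -/
theorem statement12
    (U : Set ℂ) (hUopen : IsOpen U) (hUconn : IsConnected U)
    (m n : ℕ) (hm : 1 ≤ m) (hn : 1 ≤ n) (hmn : Nat.Coprime m n)
    (α β : ℕ → ℂ → ℂ) (b : ℂ) (hb : b ≠ 0)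
    (hα : ∀ i, i < m → ∀ z ∈ U, DifferentiableAt ℂ (α i) z)
    (hβ : ∀ j, j < n → ∀ z ∈ U, DifferentiableAt ℂ (β j) z)
    (kR kS : ℕ) (ρ σ : ℕ → ℂ → ℂ)
    (hρ : ∀ i, i ≤ kR → ∀ z ∈ U, DifferentiableAt ℂ (ρ i) z)
    (hσ : ∀ j, j ≤ kS → ∀ z ∈ U, DifferentiableAt ℂ (σ j) z)
    (P Q R S : (ℂ → ℂ) → ℂ → ℂ)
    (hP : ∀ f z, P f z = iteratedDeriv m f z + ∑ i ∈ Finset.range m, α i z * iteratedDeriv i f z)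
    (hQ : ∀ f z, Q f z
      = b * iteratedDeriv n f z + ∑ j ∈ Finset.range n, β j z * iteratedDeriv j f z)
    (hR : ∀ f z, R f z = ∑ i ∈ Finset.range (kR + 1), ρ i z * iteratedDeriv i f z)
    (hS : ∀ f z, S f z = ∑ j ∈ Finset.range (kS + 1), σ j z * iteratedDeriv j f z)
    (hPQ : CommuteOn U P Q)
    (hRP : CommuteOn U R P) (hRQ : CommuteOn U R Q)
    (hSP : CommuteOn U S P) (hSQ : CommuteOn U S Q) :
    CommuteOn U R S := by
  have hdom := isDomain hUopen hUconn
  have hchar : CharZero (holomorphicSubalgebra U) :=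
    charZero_of_injective_algebraMap (algebraMap ℂ (holomorphicSubalgebra U)).injective
  obtain ⟨m, rfl⟩ := Nat.exists_eq_add_of_le' hm
  obtain ⟨E, hEmem, hE⟩ := exists_represents hUopen hα
  obtain ⟨TR, hTRmem, hTR⟩ := exists_represents hUopen fun i hi => hρ i (Nat.lt_succ_iff.1 hi)
  obtain ⟨TS, hTSmem, hTS⟩ := exists_represents hUopen fun i hi => hσ i (Nat.lt_succ_iff.1 hi)
  obtain rfl : R = _ := funext₂ hR
  obtain rfl : S = _ := funext₂ hS
  have hTP : Represents
      ((derivation hUopen : Module.End ℂ (holomorphicSubalgebra U)) ^ (m + 1) + E) P := by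
    intro f hf z
    rw [hP, LinearMap.add_apply, derivation_pow_restrict]
    exact congrArg (iteratedDeriv (m + 1) f z + ·) (hE f hf z)
  rw [← hTR.commute_iff hUopen hTS]
  exact DiffOp.commute_of_commute_monic (derivation_coordinate hUopen)
    (fun _ => exists_algebraMap_eq hUopen hUconn) (DiffOp.hasSymbol_pow_add hEmem) hTRmem hTSmem
    ((hTR.commute_iff hUopen hTP).2 hRP) ((hTS.commute_iff hUopen hTP).2 hSP)
end

section
/- Let c, w, t ∈ ℂ with w ≠ c, w ≠ −c, and c·cos(2πct) + w·i·sin(2πct) ≠ 0. Define d = −c·(w·cos(2πct) + c·i·sin(2πct))/(c·cos(2πct) + w·i·sin(2πct)). Then exp(2πi·ct)·(c + d)/(c − w) = exp(−2πi·ct)·(−c + d)/(−c − w). -/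
/-- The matching condition for `d(t)` in the genus one example: with
`d = -c·(w·cos(2πct) + c·i·sin(2πct))/(c·cos(2πct) + w·i·sin(2πct))` one has
`exp(2πi·ct)·(c+d)/(c-w) = exp(-2πi·ct)·(-c+d)/(-c-w)`. -/
theorem statement14
    (c w t d : ℂ) (hw1 : w ≠ c) (hw2 : w ≠ -c)
    (hden : c * Complex.cos (2 * (Real.pi : ℂ) * c * t)
        + w * Complex.I * Complex.sin (2 * (Real.pi : ℂ) * c * t) ≠ 0)
    (hd : d = -c * (w * Complex.cos (2 * (Real.pi : ℂ) * c * t)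
          + c * Complex.I * Complex.sin (2 * (Real.pi : ℂ) * c * t))
        / (c * Complex.cos (2 * (Real.pi : ℂ) * c * t)
          + w * Complex.I * Complex.sin (2 * (Real.pi : ℂ) * c * t))) :
    Complex.exp (2 * (Real.pi : ℂ) * Complex.I * c * t) * (c + d) / (c - w)
      = Complex.exp (-(2 * (Real.pi : ℂ) * Complex.I * c * t)) * (-c + d) / (-c - w) := by
  rw [eq_div_iff hden] at hd
  have hexp : Complex.exp (2 * (Real.pi : ℂ) * Complex.I * c * t)
      = Complex.cos (2 * (Real.pi : ℂ) * c * t)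
        + Complex.sin (2 * (Real.pi : ℂ) * c * t) * Complex.I := by
    rw [← Complex.exp_mul_I]
    ring_nf
  have hexp_neg : Complex.exp (-(2 * (Real.pi : ℂ) * Complex.I * c * t))
      = Complex.cos (2 * (Real.pi : ℂ) * c * t)
        - Complex.sin (2 * (Real.pi : ℂ) * c * t) * Complex.I := by
    rw [Complex.cos_sub_sin_I]
    ring_nf
  have hsub : c - w ≠ 0 := sub_ne_zero.mpr hw1.symm
  have hneg_sub : -c - w ≠ 0 := sub_ne_zero.mpr hw2.symm
  rw [hexp, hexp_neg, div_eq_div_iff hsub hneg_sub]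
  linear_combination (-2) * hd
end

section
/- Let z, z₀ ∈ ℂ ∖ {0} with z⁻¹ ≠ z₀⁻¹, and let c ∈ ℂ. Define ψ : ℂ → ℂ by ψ(t) = (exp(2πi·t·z⁻¹)/(z⁻¹ − z₀⁻¹))·(z⁻¹ − c·(z₀⁻¹·cos(2πct) + c·i·sin(2πct))/(c·cos(2πct) + z₀⁻¹·i·sin(2πct))). Then for every t ∈ ℂ with c·cos(2πct) + z₀⁻¹·i·sin(2πct) ≠ 0, the second complex derivative of ψ at t satisfies ψ''(t) = −4π²·(z⁻² + 2c²·(z₀⁻² − c²)/(c·cos(2πct) + z₀⁻¹·i·sin(2πct))²)·ψ(t). -/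
open Filter Topology in
/-- If `R` solves the Riccati equation `R' = k (b - R²)` near `t`, then the function
`C e^{kws} (w - R)` solves a Schrödinger equation with potential `2 (R² - b)` at `t`. -/
theorem iteratedDeriv_two_exp_mul_sub_of_riccati {R : ℂ → ℂ} {k b t : ℂ} (w C : ℂ)
    (hR : ∀ᶠ s in 𝓝 t, HasDerivAt R (k * (b - R s ^ 2)) s) :
    iteratedDeriv 2 (fun s => C * Complex.exp (k * w * s) * (w - R s)) t
      = k ^ 2 * (w ^ 2 + 2 * (R t ^ 2 - b)) * (C * Complex.exp (k * w * t) * (w - R t)) := by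
  have hexp (s : ℂ) : HasDerivAt (fun s => C * Complex.exp (k * w * s))
      (C * (Complex.exp (k * w * s) * (k * w))) s := by
    simpa using (((hasDerivAt_id s).const_mul (k * w)).cexp).const_mul C
  have hderiv : deriv (fun s => C * Complex.exp (k * w * s) * (w - R s)) =ᶠ[𝓝 t]
      fun s => C * Complex.exp (k * w * s) * (k * (w * (w - R s) - (b - R s ^ 2))) := by
    filter_upwards [hR] with s hs
    rw [((hexp s).fun_mul (hs.const_sub w)).deriv]
    ring
  have hRt := hR.self_of_nhds
  rw [iteratedDeriv_succ, iteratedDeriv_one, hderiv.deriv_eq,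
    ((hexp t).fun_mul ((((hRt.const_sub w).const_mul w).fun_sub
      ((hRt.fun_pow 2).const_sub b)).const_mul k)).deriv]
  push_cast
  ring

/-- A Pythagorean identity for `c cos + a i sin` and `a cos + c i sin`. -/
theorem sq_sub_sq_cos_add_I_mul_sin (a c x : ℂ) :
    (c * Complex.cos x + a * Complex.I * Complex.sin x) ^ 2
      - (a * Complex.cos x + c * Complex.I * Complex.sin x) ^ 2 = c ^ 2 - a ^ 2 := by
  linear_combination (c ^ 2 - a ^ 2) * Complex.sin_sq_add_cos_sq x
    + (a ^ 2 - c ^ 2) * Complex.sin x ^ 2 * Complex.I_sq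

theorem hasDerivAt_cos_add_I_mul_sin (a c m s : ℂ) :
    HasDerivAt (fun s => c * Complex.cos (m * s) + a * Complex.I * Complex.sin (m * s))
      (m * Complex.I * (a * Complex.cos (m * s) + c * Complex.I * Complex.sin (m * s))) s := by
  have hm : HasDerivAt (fun s => m * s) m s := by
    simpa using (hasDerivAt_id s).const_mul m
  refine ((hm.ccos.const_mul c).fun_add (hm.csin.const_mul (a * Complex.I))).congr_deriv ?_
  linear_combination -(m * c * Complex.sin (m * s)) * Complex.I_sq

/-- A constant multiple of the logarithmic derivative of `c cos + a i sin` solves a Riccati equation. -/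
theorem hasDerivAt_riccati (a c p s : ℂ)
    (hs : c * Complex.cos (p * c * s) + a * Complex.I * Complex.sin (p * c * s) ≠ 0) :
    HasDerivAt (fun s => c * (a * Complex.cos (p * c * s) + c * Complex.I * Complex.sin (p * c * s))
        / (c * Complex.cos (p * c * s) + a * Complex.I * Complex.sin (p * c * s)))
      (p * Complex.I * (c ^ 2 -
        (c * (a * Complex.cos (p * c * s) + c * Complex.I * Complex.sin (p * c * s))
          / (c * Complex.cos (p * c * s) + a * Complex.I * Complex.sin (p * c * s))) ^ 2)) s := by
  refine (((hasDerivAt_cos_add_I_mul_sin c a (p * c) s).const_mul c).fun_div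
    (hasDerivAt_cos_add_I_mul_sin a c (p * c) s) hs).congr_deriv ?_
  generalize c * Complex.cos (p * c * s) + a * Complex.I * Complex.sin (p * c * s) = D at hs ⊢
  field_simp

/-- The Baker–Akhiezer function of the genus one example (nodal case) solves the
second-order differential equation `ψ'' = -4π²·(z⁻² + 2c²(z₀⁻² - c²)/(c·cos(2πct)
+ z₀⁻¹·i·sin(2πct))²)·ψ`. -/
theorem statement15
    (z z₀ : ℂ) (hz : z ≠ 0) (hz₀ : z₀ ≠ 0) (hne : z⁻¹ ≠ z₀⁻¹) (c : ℂ)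
    (ψ : ℂ → ℂ)
    (hψ : ∀ t : ℂ, ψ t
      = Complex.exp (2 * (Real.pi : ℂ) * Complex.I * t * z⁻¹) / (z⁻¹ - z₀⁻¹)
        * (z⁻¹ - c * (z₀⁻¹ * Complex.cos (2 * (Real.pi : ℂ) * c * t)
              + c * Complex.I * Complex.sin (2 * (Real.pi : ℂ) * c * t))
            / (c * Complex.cos (2 * (Real.pi : ℂ) * c * t)
              + z₀⁻¹ * Complex.I * Complex.sin (2 * (Real.pi : ℂ) * c * t)))) :
    ∀ t : ℂ,
      c * Complex.cos (2 * (Real.pi : ℂ) * c * t)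
          + z₀⁻¹ * Complex.I * Complex.sin (2 * (Real.pi : ℂ) * c * t) ≠ 0 →
      iteratedDeriv 2 ψ t
        = -(4 * (Real.pi : ℂ) ^ 2)
            * (z⁻¹ ^ 2 + 2 * c ^ 2 * (z₀⁻¹ ^ 2 - c ^ 2)
                / (c * Complex.cos (2 * (Real.pi : ℂ) * c * t)
                  + z₀⁻¹ * Complex.I * Complex.sin (2 * (Real.pi : ℂ) * c * t)) ^ 2)
            * ψ t := by
  intro t ht
  have hcont : Continuous fun s : ℂ => c * Complex.cos (2 * (Real.pi : ℂ) * c * s)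
      + z₀⁻¹ * Complex.I * Complex.sin (2 * (Real.pi : ℂ) * c * s) := by
    fun_prop
  have key := iteratedDeriv_two_exp_mul_sub_of_riccati z⁻¹ (z⁻¹ - z₀⁻¹)⁻¹
    ((hcont.continuousAt.eventually_ne ht).mono fun s hs =>
      hasDerivAt_riccati z₀⁻¹ c (2 * (Real.pi : ℂ)) s hs)
  have hfun : ψ = fun s => (z⁻¹ - z₀⁻¹)⁻¹
      * Complex.exp (2 * (Real.pi : ℂ) * Complex.I * z⁻¹ * s)
      * (z⁻¹ - c * (z₀⁻¹ * Complex.cos (2 * (Real.pi : ℂ) * c * s)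
          + c * Complex.I * Complex.sin (2 * (Real.pi : ℂ) * c * s))
        / (c * Complex.cos (2 * (Real.pi : ℂ) * c * s)
          + z₀⁻¹ * Complex.I * Complex.sin (2 * (Real.pi : ℂ) * c * s))) := by
    funext s
    rw [hψ s, mul_right_comm _ s z⁻¹, div_eq_inv_mul]
  rw [← hfun] at key
  rw [key, ← congrFun hfun t]
  congr 1
  have hpyth := sq_sub_sq_cos_add_I_mul_sin z₀⁻¹ c (2 * (Real.pi : ℂ) * c * t)
  rw [mul_pow, Complex.I_sq, ← neg_sub (c ^ 2) (z₀⁻¹ ^ 2), ← hpyth]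
  generalize c * Complex.cos (2 * (Real.pi : ℂ) * c * t)
    + z₀⁻¹ * Complex.I * Complex.sin (2 * (Real.pi : ℂ) * c * t) = D at ht ⊢
  field_simp
  ring
end

section
/- Let z, z₀ ∈ ℂ ∖ {0} with z⁻¹ ≠ z₀⁻¹. Define ψ : ℂ → ℂ by ψ(t) = exp(2πi·t·z⁻¹)·(z⁻¹ − z₀⁻¹/(1 + 2πi·z₀⁻¹·t))/(z⁻¹ − z₀⁻¹). Then for every t ∈ ℂ with 1 + 2πi·z₀⁻¹·t ≠ 0, the second complex derivative of ψ at t satisfies ψ''(t) = −4π²·(z⁻² + 2·z₀⁻²/(1 + 2πi·z₀⁻¹·t)²)·ψ(t). -/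
/-- The derivative of `exp (w t a) * (a - b / (1 + w b t))` away from the pole. -/
lemma hasDerivAt_exp_mul_sub_div (w a b t : ℂ) (ht : 1 + w * b * t ≠ 0) :
    HasDerivAt (fun s : ℂ => Complex.exp (w * s * a) * (a - b / (1 + w * b * s)))
      (w * (Complex.exp (w * t * a)
        * (a ^ 2 - a * b / (1 + w * b * t) + b ^ 2 / (1 + w * b * t) ^ 2))) t := by
  have hexp : HasDerivAt (fun s : ℂ => Complex.exp (w * s * a))
      (Complex.exp (w * t * a) * (w * 1 * a)) t :=
    (((hasDerivAt_id t).const_mul w).mul_const a).cexp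
  have hlin : HasDerivAt (fun s : ℂ => 1 + w * b * s) (w * b * 1) t :=
    ((hasDerivAt_id t).const_mul (w * b)).const_add 1
  have hdiv := ((hasDerivAt_const t b).fun_div hlin ht).const_sub a
  refine (hexp.fun_mul hdiv).congr_deriv ?_
  field_simp
  ring

/-- The derivative of `exp (w t a) * (a² - a b / (1 + w b t) + b² / (1 + w b t)²)` away from
the pole. -/
lemma hasDerivAt_exp_mul_sub_div_add_div_sq (w a b t : ℂ) (ht : 1 + w * b * t ≠ 0) :
    HasDerivAt (fun s : ℂ => Complex.exp (w * s * a)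
        * (a ^ 2 - a * b / (1 + w * b * s) + b ^ 2 / (1 + w * b * s) ^ 2))
      (w * (a ^ 2 + 2 * b ^ 2 / (1 + w * b * t) ^ 2)
        * (Complex.exp (w * t * a) * (a - b / (1 + w * b * t)))) t := by
  have hexp : HasDerivAt (fun s : ℂ => Complex.exp (w * s * a))
      (Complex.exp (w * t * a) * (w * 1 * a)) t :=
    (((hasDerivAt_id t).const_mul w).mul_const a).cexp
  have hlin : HasDerivAt (fun s : ℂ => 1 + w * b * s) (w * b * 1) t :=
    ((hasDerivAt_id t).const_mul (w * b)).const_add 1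
  have hdiv := ((hasDerivAt_const t (a * b)).fun_div hlin ht).const_sub (a ^ 2)
  have hdivsq := (hasDerivAt_const t (b ^ 2)).fun_div (hlin.fun_pow 2) (pow_ne_zero 2 ht)
  refine (hexp.fun_mul (hdiv.fun_add hdivsq)).congr_deriv ?_
  clear hexp hlin hdiv hdivsq
  generalize 1 + w * b * t = u at ht ⊢
  simp only [Nat.cast_ofNat, Nat.add_one_sub_one, pow_one]
  field_simp
  ring

/-- `exp (w t a) * (a - b / (1 + w b t))` solves a second-order linear equation away from
its pole. -/
lemma iteratedDeriv_two_exp_mul_sub_div (w a b t : ℂ) (ht : 1 + w * b * t ≠ 0) :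
    iteratedDeriv 2 (fun s : ℂ => Complex.exp (w * s * a) * (a - b / (1 + w * b * s))) t
      = w ^ 2 * (a ^ 2 + 2 * b ^ 2 / (1 + w * b * t) ^ 2)
        * (Complex.exp (w * t * a) * (a - b / (1 + w * b * t))) := by
  have hne : ∀ᶠ s in nhds t, 1 + w * b * s ≠ 0 :=
    ContinuousAt.eventually_ne (by fun_prop) ht
  have hderiv := hne.mono fun s hs => (hasDerivAt_exp_mul_sub_div w a b s hs).deriv
  rw [iteratedDeriv_succ, iteratedDeriv_one, Filter.EventuallyEq.deriv_eq hderiv,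
    ((hasDerivAt_exp_mul_sub_div_add_div_sq w a b t ht).const_mul w).deriv]
  ring

/-- The Baker–Akhiezer function of the genus one example (cuspidal case, limit `c → 0`)
solves the second-order differential equation
`ψ'' = -4π²·(z⁻² + 2z₀⁻²/(1 + 2πi·z₀⁻¹·t)²)·ψ`. -/
theorem statement16
    (z z₀ : ℂ) (hz : z ≠ 0) (hz₀ : z₀ ≠ 0) (hne : z⁻¹ ≠ z₀⁻¹)
    (ψ : ℂ → ℂ)
    (hψ : ∀ t : ℂ, ψ t
      = Complex.exp (2 * (Real.pi : ℂ) * Complex.I * t * z⁻¹)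
          * (z⁻¹ - z₀⁻¹ / (1 + 2 * (Real.pi : ℂ) * Complex.I * z₀⁻¹ * t))
          / (z⁻¹ - z₀⁻¹)) :
    ∀ t : ℂ, 1 + 2 * (Real.pi : ℂ) * Complex.I * z₀⁻¹ * t ≠ 0 →
      iteratedDeriv 2 ψ t
        = -(4 * (Real.pi : ℂ) ^ 2)
            * (z⁻¹ ^ 2 + 2 * z₀⁻¹ ^ 2
                / (1 + 2 * (Real.pi : ℂ) * Complex.I * z₀⁻¹ * t) ^ 2)
            * ψ t := by
  intro t ht
  obtain rfl := funext hψ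
  have hfun : (fun s : ℂ => Complex.exp (2 * (Real.pi : ℂ) * Complex.I * s * z⁻¹)
          * (z⁻¹ - z₀⁻¹ / (1 + 2 * (Real.pi : ℂ) * Complex.I * z₀⁻¹ * s))
          / (z⁻¹ - z₀⁻¹))
      = fun s : ℂ => (z⁻¹ - z₀⁻¹)⁻¹ * (Complex.exp (2 * (Real.pi : ℂ) * Complex.I * s * z⁻¹)
          * (z⁻¹ - z₀⁻¹ / (1 + 2 * (Real.pi : ℂ) * Complex.I * z₀⁻¹ * s))) := by
    funext s
    rw [div_eq_inv_mul]
  have hsq : (2 * (Real.pi : ℂ) * Complex.I) ^ 2 = -(4 * (Real.pi : ℂ) ^ 2) := by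
    rw [mul_pow, Complex.I_sq]
    ring
  rw [hfun, iteratedDeriv_const_mul_field,
    iteratedDeriv_two_exp_mul_sub_div (2 * (Real.pi : ℂ) * Complex.I) z⁻¹ z₀⁻¹ t ht, hsq]
  ring
end
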